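/- arXiv:1307.2155 — 6 statements merged into one kernel-verified Lean document; each statement's English description precedes it below -/
import Mathlib

section
/- Let n ≥ 1, let U ⊆ (Fin n → ℝ) be open, let θ : U → (Fin n → ℝ) be a map whose components are differentiable at a point p ∈ U, and let c, c' : U → (Fin n → Fin n → Fin n → ℝ) be arrays of Christoffel symbols, each symmetric in its first two indices. Assume c and c' are projectively equivalent, i.e. there is β : U → (Fin n → ℝ) such that for all q ∈ U and all i, j, k: c'(q) i j k = c(q) i j k + (if j = k then β(q) i else 0) + (if i = k then β(q) j else 0). Then for all i, j: ∂_i θ_j(p) − Σ_k Π(c(p)) i j k · θ_k(p) = ∂_i θ_j(p) − Σ_k Π(c'(p)) i j k · θ_k(p), where ∂_i θ_j(p) := fderiv ℝ (fun q => θ q j) p (Pi.single i 1). -/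
/-- The symbol of the projective connection associated to Christoffel symbols `c`:
`Π(c) i j k = c i j k − (1/(n+1))·((if i = k then t(c) j else 0) + (if j = k then t(c) i else 0))`,
where `t(c) i = Σ_l c i l l`. -/
noncomputable def projSymbol (n : ℕ) (c : Fin n → Fin n → Fin n → ℝ) (i j k : Fin n) : ℝ :=
  c i j k - (1 / ((n : ℝ) + 1)) *
    ((if i = k then ∑ l, c j l l else 0) + (if j = k then ∑ l, c i l l else 0))

/-- **Theorem 3.3.1 (local form).** If the Christoffel symbols `c` and `c'` are projectively
equivalent on an open set `U`, then the components `∂_i θ_j − Π_{ij}^k θ_k` of `∇Θ`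
computed at `p ∈ U` from `c` and from `c'` coincide. -/
theorem projective_invariance_of_nablaTheta
    (n : ℕ) (hn : 1 ≤ n) (U : Set (Fin n → ℝ)) (hU : IsOpen U)
    (θ : (Fin n → ℝ) → Fin n → ℝ) (p : Fin n → ℝ) (hp : p ∈ U)
    (hθ : ∀ j, DifferentiableAt ℝ (fun q => θ q j) p)
    (c c' : (Fin n → ℝ) → Fin n → Fin n → Fin n → ℝ)
    (hsym : ∀ q ∈ U, ∀ i j k, c q i j k = c q j i k)
    (hsym' : ∀ q ∈ U, ∀ i j k, c' q i j k = c' q j i k)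
    (hproj : ∃ β : (Fin n → ℝ) → Fin n → ℝ, ∀ q ∈ U, ∀ i j k,
      c' q i j k = c q i j k
        + (if j = k then β q i else 0) + (if i = k then β q j else 0)) :
    ∀ i j : Fin n,
      fderiv ℝ (fun q => θ q j) p (Pi.single i 1)
          - ∑ k, projSymbol n (c p) i j k * θ p k
        = fderiv ℝ (fun q => θ q j) p (Pi.single i 1)
          - ∑ k, projSymbol n (c' p) i j k * θ p k := by
  obtain ⟨β, hβ⟩ := hproj
  have ht : ∀ i, ∑ l, c' p i l l = ∑ l, c p i l l + ((n : ℝ) + 1) * β p i := by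
    intro i
    simp only [hβ p hp, Finset.sum_add_distrib]
    simp
    ring
  have hn1 : (n : ℝ) + 1 ≠ 0 := by positivity
  have hP : ∀ i j k, projSymbol n (c p) i j k = projSymbol n (c' p) i j k := by
    intro i j k
    unfold projSymbol
    rw [ht i, ht j, hβ p hp i j k]
    split_ifs <;> field_simp <;> ring
  intro i j
  simp only [hP]
end

section
/- Let ℓ ≥ 1 and n = 2ℓ+1, let U ⊆ (Fin n → ℝ) be open, and let p ∈ U. Let g : U → Matrix (Fin n) (Fin n) ℝ be a C² map taking values in symmetric invertible matrices, with Levi-Civita Christoffel symbols Γ. Let θ : U → (Fin n → ℝ) be differentiable with ∂_i θ_j(q) + ∂_j θ_i(q) = 0 for all q ∈ U and all i, j (θ is a Killing 1-form for the flat metric), where ∂_i θ_j(q) := fderiv ℝ (fun r => θ r j) q (Pi.single i 1). Assume that Π(Γ(q)) i j k = 0 for all q ∈ U and all i, j, k (the coordinates are adapted coordinates of a projectively flat metric, as for a metric of constant sectional curvature by Beltrami's theorem). Then the scalar part of the contact Riemannian curl vanishes at p: Σ_{i,j} (g(p)⁻¹) i j · (∂_i θ_j(p) − Σ_k Π(Γ(p))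 i j k · θ_k(p)) = 0. -/
/-- Partial derivative of a scalar function on `Fin n → ℝ` in the `i`-th coordinate
direction. -/
noncomputable def pder (n : ℕ) (i : Fin n) (f : (Fin n → ℝ) → ℝ) (q : Fin n → ℝ) : ℝ :=
  fderiv ℝ f q (Pi.single i 1)

/-- The Levi-Civita Christoffel symbols of a metric `g`:
`Γ(q) i j k = (1/2)·Σ_l (g(q)⁻¹) k l · (∂_i g_{jl} + ∂_j g_{il} − ∂_l g_{ij})(q)`. -/
noncomputable def christoffel (n : ℕ) (g : (Fin n → ℝ) → Matrix (Fin n) (Fin n) ℝ)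
    (q : Fin n → ℝ) (i j k : Fin n) : ℝ :=
  (1 / 2) * ∑ l, (g q)⁻¹ k l *
    (pder n i (fun r => g r j l) q + pder n j (fun r => g r i l) q
      - pder n l (fun r => g r i j) q)

/-- **Corollary 3.4.1 (local form).** In adapted coordinates of a projectively flat metric
(`Π(Γ) ≡ 0` on `U`), if the contact form `θ` is a Killing 1-form for the flat metric
(`∂_i θ_j + ∂_j θ_i = 0`), then the scalar part of the contact Riemannian curl vanishes. -/
theorem curl_vanishes_of_projectively_flat_and_Killing
    (ℓ : ℕ) (hℓ : 1 ≤ ℓ) (n : ℕ) (hn : n = 2 * ℓ + 1)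
    (U : Set (Fin n → ℝ)) (hU : IsOpen U) (p : Fin n → ℝ) (hp : p ∈ U)
    (g : (Fin n → ℝ) → Matrix (Fin n) (Fin n) ℝ)
    (hgC2 : ∀ i j, ContDiffOn ℝ 2 (fun q => g q i j) U)
    (hgsym : ∀ q ∈ U, (g q).IsSymm)
    (hginv : ∀ q ∈ U, IsUnit (g q).det)
    (θ : (Fin n → ℝ) → Fin n → ℝ)
    (hθdiff : ∀ q ∈ U, ∀ j, DifferentiableAt ℝ (fun r => θ r j) q)
    (hKilling : ∀ q ∈ U, ∀ i j,
      pder n i (fun r => θ r j) q + pder n j (fun r => θ r i) q = 0)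
    (hflat : ∀ q ∈ U, ∀ i j k, projSymbol n (christoffel n g q) i j k = 0) :
    ∑ i, ∑ j, (g p)⁻¹ i j *
      (pder n i (fun r => θ r j) p
        - ∑ k, projSymbol n (christoffel n g p) i j k * θ p k) = 0 := by
  have hs : ∀ i j, (g p)⁻¹ i j = (g p)⁻¹ j i := by
    intro i j
    have h : ((g p)⁻¹).transpose = (g p)⁻¹ := by
      rw [Matrix.transpose_nonsing_inv, (hgsym p hp).eq]
    exact congrFun (congrFun h j) i
  simp only [hflat p hp, zero_mul, Finset.sum_const_zero, sub_zero]
  have key : ∑ i, ∑ j, (g p)⁻¹ i j * pder n i (fun r => θ r j) p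
      = - ∑ i, ∑ j, (g p)⁻¹ i j * pder n i (fun r => θ r j) p := by
    conv_lhs => rw [Finset.sum_comm]
    simp only [← Finset.sum_neg_distrib]
    refine Finset.sum_congr rfl fun i _ => Finset.sum_congr rfl fun j _ => ?_
    rw [hs j i, eq_neg_of_add_eq_zero_left (hKilling p hp j i), mul_neg]
  linarith
end

section
/- Let n ≥ 1 and let c, c' : Fin n → Fin n → Fin n → ℝ be symmetric in their first two arguments (c i j k = c j i k and c' i j k = c' j i k for all i, j, k). Then Π(c) = Π(c') (i.e., Π(c) i j k = Π(c') i j k for all i, j, k) if and only if there exists β : Fin n → ℝ such that for all i, j, k: c' i j k = c i j k + (if j = k then β i else 0) + (if i = k then β j else 0). -/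
/-- **Section 3.3.** Two symmetric affine connections have the same projective symbol
if and only if their Christoffel symbols differ by `δ_j^k β_i + δ_i^k β_j`
for some 1-form `β`. -/
theorem projSymbol_eq_iff_projectively_equivalent
    (n : ℕ) (hn : 1 ≤ n) (c c' : Fin n → Fin n → Fin n → ℝ)
    (hc : ∀ i j k, c i j k = c j i k) (hc' : ∀ i j k, c' i j k = c' j i k) :
    (∀ i j k, projSymbol n c i j k = projSymbol n c' i j k) ↔
      ∃ β : Fin n → ℝ, ∀ i j k,
        c' i j k = c i j k + (if j = k then β i else 0) + (if i = k then β j else 0) := by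
  have hn1 : (n : ℝ) + 1 ≠ 0 := by positivity
  constructor
  · intro h
    refine ⟨fun i => (1 / ((n : ℝ) + 1)) * (∑ l, c' i l l - ∑ l, c i l l), fun i j k => ?_⟩
    have h1 := h i j k
    unfold projSymbol at h1
    split_ifs at h1 ⊢ <;> linear_combination -h1
  · rintro ⟨β, h⟩ i j k
    have ht : ∀ i, ∑ l, c' i l l = ∑ l, c i l l + ((n : ℝ) + 1) * β i := by
      intro i
      simp only [h, Finset.sum_add_distrib]
      simp
      ring
    unfold projSymbol
    rw [ht i, ht j, h i j k]
    split_ifs <;> field_simp <;> ring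
end

section
/- Let E be a real module, let ι : E →ₗ[ℝ] ExteriorAlgebra ℝ E be the canonical linear map, and let ℓ : ℕ. For every a : ℝ, every θ and β in the range of ι, and every ω in the submodule product (LinearMap.range ι) * (LinearMap.range ι) of the exterior algebra (i.e., ω is a sum of products of two degree-one elements), one has (a • θ) * (a • ω + β * θ)^ℓ = a^(ℓ+1) • (θ * ω^ℓ) in ExteriorAlgebra ℝ E. -/
/-- **Proposition 2.3.2 (pointwise algebraic core).** If `θ, β` are degree-one elements of
the exterior algebra and `ω` is a sum of products of two degree-one elements, then
`(a•θ) * (a•ω + β*θ)^ℓ = a^(ℓ+1) • (θ * ω^ℓ)`. This is the identity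
`(Fθ) ∧ (d(Fθ))^ℓ = F^{ℓ+1} θ ∧ (dθ)^ℓ` at a point. -/
theorem smul_contact_volume (E : Type*) [AddCommGroup E] [Module ℝ E] (ℓ : ℕ)
    (a : ℝ) (θ β ω : ExteriorAlgebra ℝ E)
    (hθ : θ ∈ LinearMap.range (ExteriorAlgebra.ι ℝ : E →ₗ[ℝ] ExteriorAlgebra ℝ E))
    (hβ : β ∈ LinearMap.range (ExteriorAlgebra.ι ℝ : E →ₗ[ℝ] ExteriorAlgebra ℝ E))
    (hω : ω ∈ (LinearMap.range (ExteriorAlgebra.ι ℝ : E →ₗ[ℝ] ExteriorAlgebra ℝ E) *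
        LinearMap.range (ExteriorAlgebra.ι ℝ : E →ₗ[ℝ] ExteriorAlgebra ℝ E) :
        Submodule ℝ (ExteriorAlgebra ℝ E))) :
    (a • θ) * (a • ω + β * θ) ^ ℓ = a ^ (ℓ + 1) • (θ * ω ^ ℓ) := by
  obtain ⟨t, rfl⟩ := hθ
  obtain ⟨b, rfl⟩ := hβ
  have anti : ∀ x y : E, ExteriorAlgebra.ι ℝ x * ExteriorAlgebra.ι ℝ y
      = -(ExteriorAlgebra.ι ℝ y * ExteriorAlgebra.ι ℝ x) := fun x y =>
    eq_neg_of_add_eq_zero_left (ExteriorAlgebra.ι_add_mul_swap x y)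
  have hc : ExteriorAlgebra.ι ℝ t * ω = ω * ExteriorAlgebra.ι ℝ t := by
    induction hω using Submodule.mul_induction_on' with
    | mem_mul_mem m hm n hn =>
      obtain ⟨u, rfl⟩ := hm
      obtain ⟨v, rfl⟩ := hn
      rw [← mul_assoc, anti t u, neg_mul, mul_assoc, anti t v, mul_neg, neg_neg, mul_assoc]
    | add x _ y _ hx hy => rw [mul_add, add_mul, hx, hy]
  have h0 : ExteriorAlgebra.ι ℝ t * (ExteriorAlgebra.ι ℝ b * ExteriorAlgebra.ι ℝ t) = 0 := by
    rw [anti b t, mul_neg, ← mul_assoc, ExteriorAlgebra.ι_sq_zero, zero_mul, neg_zero]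
  have h1 : ExteriorAlgebra.ι ℝ t * (a • ω + ExteriorAlgebra.ι ℝ b * ExteriorAlgebra.ι ℝ t)
      = a • (ω * ExteriorAlgebra.ι ℝ t) := by
    rw [mul_add, h0, add_zero, mul_smul_comm, hc]
  induction ℓ with
  | zero => simp
  | succ n ih =>
    rw [pow_succ', ← mul_assoc, smul_mul_assoc, h1, ← mul_smul_comm, smul_mul_assoc,
      mul_assoc, ih, mul_smul_comm, smul_smul, ← mul_assoc, ← hc, mul_assoc, ← pow_succ',
      ← pow_succ']
end

section
/- Let E be a real module, let ι : E →ₗ[ℝ] ExteriorAlgebra ℝ E be the canonical linear map, and let ℓ ≥ 1. For all families of vectors e, f : Fin ℓ → E, every vector h ∈ E, and all coefficients a, b : Fin ℓ → ℝ, one has (ι h + Σᵢ (a i • ι (f i) − b i • ι (e i))) * (Σᵢ ι (e i) * ι (f i))^ℓ = ((−1)^(ℓ(ℓ−1)/2) · ℓ!) • ((∏ᵢ ι (e i)) * (∏ᵢ ι (f i)) * ι h), where the products ∏ᵢ over Fin ℓ are taken in increasing order of the index. -/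
namespace DarbouxAux

open ExteriorAlgebra

theorem swap {E : Type*} [AddCommGroup E] [Module ℝ E] (x y : E) :
    ι ℝ x * ι ℝ y = -(ι ℝ y * ι ℝ x) :=
  eq_neg_of_add_eq_zero_left (ι_add_mul_swap x y)

theorem comm {E : Type*} [AddCommGroup E] [Module ℝ E] (x y z : E) :
    Commute (ι ℝ z) (ι ℝ x * ι ℝ y) := by
  unfold Commute SemiconjBy
  rw [← mul_assoc, swap z x, neg_mul, mul_assoc, swap z y, mul_neg, neg_neg, mul_assoc]

theorem sq_zero {E : Type*} [AddCommGroup E] [Module ℝ E] (x y : E) :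
    (ι ℝ x * ι ℝ y) * (ι ℝ x * ι ℝ y) = 0 := by
  rw [mul_assoc, (comm x y y).eq, mul_assoc, ι_sq_zero, mul_zero, mul_zero]

theorem pow_add {A : Type*} [Ring A] (w S : A) (hw : w * w = 0) (hc : Commute w S) (m : ℕ) :
    (w + S) ^ (m + 1) = S ^ (m + 1) + (m + 1) • (w * S ^ m) := by
  induction m with
  | zero => simp [add_comm]
  | succ m ih =>
    have h1 : w * S ^ (m + 1) = S ^ (m + 1) * w := (hc.pow_right _).eq
    have h2 : w * S ^ m * w = 0 := by
      rw [mul_assoc, ← (hc.pow_right m).eq, ← mul_assoc, hw, zero_mul]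
    rw [_root_.pow_succ (w + S), ih, mul_add, add_mul, add_mul, smul_mul_assoc, smul_mul_assoc, h2,
      smul_zero, add_zero, mul_assoc w, ← _root_.pow_succ, ← _root_.pow_succ, ← h1,
      succ_nsmul _ (m + 1)]
    abel

theorem pow_sum {E : Type*} [AddCommGroup E] [Module ℝ E] (n : ℕ) (e f : Fin n → E) :
    (∑ i, ι ℝ (e i) * ι ℝ (f i)) ^ n
      = n.factorial • (List.ofFn fun i => ι ℝ (e i) * ι ℝ (f i)).prod ∧
    (∑ i, ι ℝ (e i) * ι ℝ (f i)) ^ (n + 1) = 0 := by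
  induction n with
  | zero => simp
  | succ n ih =>
    obtain ⟨h1, h2⟩ := ih (fun i => e i.succ) (fun i => f i.succ)
    have hc : Commute (ι ℝ (e 0) * ι ℝ (f 0)) (∑ i : Fin n, ι ℝ (e i.succ) * ι ℝ (f i.succ)) :=
      Commute.sum_right _ _ _ fun i _ => (comm _ _ _).mul_left (comm _ _ _)
    rw [Fin.sum_univ_succ, pow_add _ _ (sq_zero _ _) hc, pow_add _ _ (sq_zero _ _) hc,
      _root_.pow_succ _ (n + 1), h2, h1, mul_smul_comm, smul_smul]
    simp [List.ofFn_succ, Nat.factorial_succ]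

theorem move {E : Type*} [AddCommGroup E] [Module ℝ E] (n : ℕ) (e : Fin n → E) (z : E) :
    ι ℝ z * (List.ofFn fun i => ι ℝ (e i)).prod
      = (-1 : ℝ) ^ n • ((List.ofFn fun i => ι ℝ (e i)).prod * ι ℝ z) := by
  induction n with
  | zero => simp
  | succ n ih =>
    rw [List.ofFn_succ, List.prod_cons, ← mul_assoc, swap z, neg_mul, mul_assoc, ih,
      _root_.pow_succ, mul_smul_comm, mul_assoc]
    simp

theorem prod_split {E : Type*} [AddCommGroup E] [Module ℝ E] (n : ℕ) (e f : Fin n → E) :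
    (List.ofFn fun i => ι ℝ (e i) * ι ℝ (f i)).prod
      = (-1 : ℝ) ^ (n * (n - 1) / 2) •
        ((List.ofFn fun i => ι ℝ (e i)).prod * (List.ofFn fun i => ι ℝ (f i)).prod) := by
  induction n with
  | zero => simp
  | succ n ih =>
    have hn : (n + 1) * (n + 1 - 1) / 2 = n * (n - 1) / 2 + n := by
      rw [← Finset.sum_range_id_mul_two, Nat.mul_div_cancel _ two_pos,
        ← Finset.sum_range_id_mul_two, Nat.mul_div_cancel _ two_pos, Finset.sum_range_succ]
    rw [hn, List.ofFn_succ, List.ofFn_succ, List.ofFn_succ, List.prod_cons, List.prod_cons,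
      List.prod_cons, ih, mul_smul_comm, _root_.pow_add, mul_smul]
    congr 1
    rw [mul_assoc, ← mul_assoc (ι ℝ (f 0)), move]
    simp [mul_assoc]

theorem kill {E : Type*} [AddCommGroup E] [Module ℝ E] (n : ℕ) (e f : Fin n → E) (j : Fin n) :
    ι ℝ (e j) * (List.ofFn fun i => ι ℝ (e i) * ι ℝ (f i)).prod = 0 ∧
    ι ℝ (f j) * (List.ofFn fun i => ι ℝ (e i) * ι ℝ (f i)).prod = 0 := by
  induction n with
  | zero => exact j.elim0
  | succ n ih =>
    rw [List.ofFn_succ, List.prod_cons]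
    refine Fin.cases ?_ (fun k => ?_) j
    · constructor
      · rw [← mul_assoc, ← mul_assoc, ι_sq_zero, zero_mul, zero_mul]
      · rw [← mul_assoc, (comm _ _ _).eq, mul_assoc (ι ℝ (e 0)), ι_sq_zero, mul_zero, zero_mul]
    · obtain ⟨h1, h2⟩ := ih (fun i => e i.succ) (fun i => f i.succ) k
      constructor
      · rw [← mul_assoc, (comm _ _ _).eq, mul_assoc, h1, mul_zero]
      · rw [← mul_assoc, (comm _ _ _).eq, mul_assoc, h2, mul_zero]

theorem comm_prod {E : Type*} [AddCommGroup E] [Module ℝ E] (n : ℕ) (e f : Fin n → E) (z : E) :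
    Commute (ι ℝ z) (List.ofFn fun i => ι ℝ (e i) * ι ℝ (f i)).prod := by
  apply Commute.list_prod_right
  intro x hx
  obtain ⟨i, rfl⟩ := (List.mem_ofFn' _ _).1 hx
  exact comm _ _ _

end DarbouxAux

/-- **Example 2.3.3 (pointwise exterior-algebra form).** For the Darboux contact form,
`θ_Dar ∧ (dθ_Dar)^ℓ = (−1)^{ℓ(ℓ−1)/2} ℓ! · dx¹ ∧ ⋯ ∧ dxℓ ∧ dy¹ ∧ ⋯ ∧ dyℓ ∧ dz`.
At a point, with `dxⁱ = ι(e i)`, `dyⁱ = ι(f i)`, `dz = ι(h)`, `a i = xⁱ/2`, `b i = yⁱ/2`. -/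
theorem darboux_contact_volume (E : Type*) [AddCommGroup E] [Module ℝ E]
    (ℓ : ℕ) (hℓ : 1 ≤ ℓ) (e f : Fin ℓ → E) (h : E) (a b : Fin ℓ → ℝ) :
    (ExteriorAlgebra.ι ℝ h +
        ∑ i, (a i • ExteriorAlgebra.ι ℝ (f i) - b i • ExteriorAlgebra.ι ℝ (e i))) *
      (∑ i, ExteriorAlgebra.ι ℝ (e i) * ExteriorAlgebra.ι ℝ (f i)) ^ ℓ
    = ((-1 : ℝ) ^ (ℓ * (ℓ - 1) / 2) * (Nat.factorial ℓ : ℝ)) •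
        ((List.ofFn fun i => ExteriorAlgebra.ι ℝ (e i)).prod *
          (List.ofFn fun i => ExteriorAlgebra.ι ℝ (f i)).prod *
          ExteriorAlgebra.ι ℝ h) := by
  have hs : (∑ i, (a i • ExteriorAlgebra.ι ℝ (f i) - b i • ExteriorAlgebra.ι ℝ (e i))) *
      (List.ofFn fun i => ExteriorAlgebra.ι ℝ (e i) * ExteriorAlgebra.ι ℝ (f i)).prod = 0 := by
    rw [Finset.sum_mul]
    refine Finset.sum_eq_zero fun i _ => ?_
    rw [sub_mul, smul_mul_assoc, smul_mul_assoc, (DarbouxAux.kill ℓ e f i).1,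
      (DarbouxAux.kill ℓ e f i).2, smul_zero, smul_zero, sub_zero]
  rw [(DarbouxAux.pow_sum ℓ e f).1, mul_smul_comm, add_mul, hs, add_zero,
    (DarbouxAux.comm_prod ℓ e f h).eq, DarbouxAux.prod_split, smul_mul_assoc,
    ← Nat.cast_smul_eq_nsmul ℝ, smul_smul, mul_comm (Nat.factorial ℓ : ℝ)]
end

section
/- Let g_{S³} : ℝ³ → Matrix (Fin 3) (Fin 3) ℝ be given at p = (x,y,z) by the symmetric matrix F·[[y²+z²+1, −xy, −xz], [−xy, x²+z²+1, −yz], [−xz, −yz, x²+y²+1]] with F = (x²+y²+z²+1)^{−2}; this matrix is positive definite, hence invertible, at every point. Let Γ(p) i j k := (1/2)·Σ_l (g_{S³}(p)⁻¹) k l · (∂_i (g_{S³})_{jl}(p) + ∂_j (g_{S³})_{il}(p) − ∂_l (g_{S³})_{ij}(p)) be its Levi-Civita Christoffel symbols. Then the projective symbol vanishes identically: for all p ∈ ℝ³ and all i, j, k, Π(Γ(p)) i j k = 0, where Π(c) i j k := c i j k − (1/4)·((if i = k then Σ_l c j l l else 0) + (if j = k then Σ_l c i l l else 0)). -/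
/-- The standard basis vectors of `ℝ³ = ℝ × ℝ × ℝ`. -/
def bv3 : Fin 3 → ℝ × ℝ × ℝ := ![(1, 0, 0), (0, 1, 0), (0, 0, 1)]

/-- The partial derivative `∂_i f (p)` on `ℝ³`. -/
noncomputable def pd3 (i : Fin 3) (f : ℝ × ℝ × ℝ → ℝ) (p : ℝ × ℝ × ℝ) : ℝ :=
  fderiv ℝ f p (bv3 i)

/-- The round metric of `S³` in the affine coordinates `(x, y, z)`:
`g = F·[[y²+z²+1, −xy, −xz], [−xy, x²+z²+1, −yz], [−xz, −yz, x²+y²+1]]`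
with `F = (x²+y²+z²+1)^{−2}`. -/
noncomputable def gS3 (p : ℝ × ℝ × ℝ) : Matrix (Fin 3) (Fin 3) ℝ :=
  ((p.1 ^ 2 + p.2.1 ^ 2 + p.2.2 ^ 2 + 1) ^ 2)⁻¹ •
    !![p.2.1 ^ 2 + p.2.2 ^ 2 + 1, -(p.1 * p.2.1), -(p.1 * p.2.2);
       -(p.1 * p.2.1), p.1 ^ 2 + p.2.2 ^ 2 + 1, -(p.2.1 * p.2.2);
       -(p.1 * p.2.2), -(p.2.1 * p.2.2), p.1 ^ 2 + p.2.1 ^ 2 + 1]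

/-- The Levi-Civita Christoffel symbols of a metric `g` on `ℝ³`:
`Γ(p) i j k = (1/2)·Σ_l (g(p)⁻¹) k l · (∂_i g_{jl} + ∂_j g_{il} − ∂_l g_{ij})(p)`. -/
noncomputable def christoffel3 (g : ℝ × ℝ × ℝ → Matrix (Fin 3) (Fin 3) ℝ)
    (p : ℝ × ℝ × ℝ) (i j k : Fin 3) : ℝ :=
  (1 / 2) * ∑ l, (g p)⁻¹ k l *
    (pd3 i (fun q => g q j l) p + pd3 j (fun q => g q i l) p - pd3 l (fun q => g q i j) p)

/-- The projective symbol, for `n = 3` (so `n + 1 = 4`):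
`Π(c) i j k = c i j k − (1/4)·((if i = k then Σ_l c j l l else 0) + (if j = k then Σ_l c i l l else 0))`. -/
noncomputable def projSymbol3 (c : Fin 3 → Fin 3 → Fin 3 → ℝ) (i j k : Fin 3) : ℝ :=
  c i j k - (1 / 4) *
    ((if i = k then ∑ l, c j l l else 0) + (if j = k then ∑ l, c i l l else 0))

/-- Coordinates. -/
def co3 (p : ℝ × ℝ × ℝ) : Fin 3 → ℝ := ![p.1, p.2.1, p.2.2]

/-- The conformal factor. -/
noncomputable def sS3 (p : ℝ × ℝ × ℝ) : ℝ := p.1 ^ 2 + p.2.1 ^ 2 + p.2.2 ^ 2 + 1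

/-- Kronecker delta. -/
noncomputable def dl3 (i j : Fin 3) : ℝ := if i = j then 1 else 0

lemma sS3_pos (p : ℝ × ℝ × ℝ) : 0 < sS3 p := by unfold sS3; positivity

lemma gS3_apply (p : ℝ × ℝ × ℝ) (i j : Fin 3) :
    gS3 p i j = (sS3 p ^ 2)⁻¹ * (dl3 i j * sS3 p - co3 p i * co3 p j) := by
  fin_cases i <;> fin_cases j <;> simp [gS3, sS3, dl3, co3] <;> left <;> ring

lemma gS3_inv (p : ℝ × ℝ × ℝ) :
    (gS3 p)⁻¹ = Matrix.of (fun i j => sS3 p * (dl3 i j + co3 p i * co3 p j)) := by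
  have h := (sS3_pos p).ne'
  apply Matrix.inv_eq_right_inv
  ext i j
  simp only [Matrix.mul_apply, Fin.sum_univ_three, gS3_apply, Matrix.of_apply, Matrix.one_apply]
  fin_cases i <;> fin_cases j <;> simp [dl3, co3] <;> field_simp <;> simp only [sS3] <;> ring

lemma co3_hasFDerivAt (p : ℝ × ℝ × ℝ) (i : Fin 3) :
    ∃ L : ℝ × ℝ × ℝ →L[ℝ] ℝ, HasFDerivAt (fun q => co3 q i) L p ∧ ∀ k, L (bv3 k) = dl3 k i := by
  fin_cases i
  · exact ⟨_, hasFDerivAt_fst, fun k => by fin_cases k <;> simp [bv3, dl3]⟩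
  · exact ⟨(ContinuousLinearMap.fst ℝ ℝ ℝ).comp (ContinuousLinearMap.snd ℝ ℝ (ℝ × ℝ)),
      ((ContinuousLinearMap.fst ℝ ℝ ℝ).comp (ContinuousLinearMap.snd ℝ ℝ (ℝ × ℝ))).hasFDerivAt,
      fun k => by fin_cases k <;> simp [bv3, dl3]⟩
  · exact ⟨(ContinuousLinearMap.snd ℝ ℝ ℝ).comp (ContinuousLinearMap.snd ℝ ℝ (ℝ × ℝ)),
      ((ContinuousLinearMap.snd ℝ ℝ ℝ).comp (ContinuousLinearMap.snd ℝ ℝ (ℝ × ℝ))).hasFDerivAt,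
      fun k => by fin_cases k <;> simp [bv3, dl3]⟩

lemma sS3_eq (p : ℝ × ℝ × ℝ) : sS3 p = co3 p 0 ^ 2 + co3 p 1 ^ 2 + co3 p 2 ^ 2 + 1 := by
  simp [sS3, co3]

lemma pd3_gS3 (p : ℝ × ℝ × ℝ) (i j l : Fin 3) :
    pd3 i (fun q => gS3 q j l) p =
      -2 * co3 p i * dl3 j l / sS3 p ^ 2 - (dl3 i j * co3 p l + co3 p j * dl3 i l) / sS3 p ^ 2
        + 4 * co3 p i * co3 p j * co3 p l / sS3 p ^ 3 := by
  have h := (sS3_pos p).ne'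
  have hS : ∃ L : ℝ × ℝ × ℝ →L[ℝ] ℝ, HasFDerivAt sS3 L p ∧ ∀ k, L (bv3 k) = 2 * co3 p k := by
    obtain ⟨A, hA, hA'⟩ := co3_hasFDerivAt p 0
    obtain ⟨B, hB, hB'⟩ := co3_hasFDerivAt p 1
    obtain ⟨C, hC, hC'⟩ := co3_hasFDerivAt p 2
    refine ⟨_, ((((hA.pow 2).add (hB.pow 2)).add (hC.pow 2)).add_const 1).congr_of_eventuallyEq
      (Filter.Eventually.of_forall fun q => sS3_eq q), fun k => ?_⟩
    simp only [ContinuousLinearMap.add_apply, ContinuousLinearMap.smul_apply, hA', hB', hC']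
    fin_cases k <;> simp [dl3]
  obtain ⟨A, hA, hA'⟩ := co3_hasFDerivAt p j
  obtain ⟨B, hB, hB'⟩ := co3_hasFDerivAt p l
  obtain ⟨C, hC, hC'⟩ := hS
  have hI := (hasDerivAt_inv (pow_ne_zero 2 h)).comp_hasFDerivAt p (hC.pow 2)
  have hG := hI.mul ((hC.const_mul (dl3 j l)).sub (hA.mul hB))
  have : (fun q => gS3 q j l) = _ := funext fun q => gS3_apply q j l
  unfold pd3
  rw [this]
  erw [HasFDerivAt.fderiv hG]
  simp [hA', hB', hC']
  field_simp
  ring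

lemma christoffel3_gS3 (p : ℝ × ℝ × ℝ) (i j k : Fin 3) :
    christoffel3 gS3 p i j k = -(co3 p i * dl3 j k + co3 p j * dl3 i k) / sS3 p := by
  have h := (sS3_pos p).ne'
  simp only [christoffel3, pd3_gS3, gS3_inv, Matrix.of_apply, Fin.sum_univ_three]
  have e := sS3_eq p
  fin_cases i <;> fin_cases j <;> fin_cases k <;> simp [dl3] <;> field_simp <;> rw [e] <;> ring

/-- **Used in Proposition 6.1.1(i).** The round metric `g_{S³}` is positive definite at
every point, and its Levi-Civita connection is projectively flat in the affine
coordinates: the projective symbol of its Christoffel symbols vanishes identically. -/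
theorem projSymbol_gS3_eq_zero :
    (∀ p : ℝ × ℝ × ℝ, (gS3 p).PosDef) ∧
    (∀ (p : ℝ × ℝ × ℝ) (i j k : Fin 3), projSymbol3 (christoffel3 gS3 p) i j k = 0) := by
  refine ⟨fun p => ?_, fun p i j k => ?_⟩
  · have h := sS3_pos p
    refine Matrix.PosDef.of_dotProduct_mulVec_pos ?_ fun v hv => ?_
    · ext i j
      simp only [Matrix.conjTranspose_apply, gS3_apply, star_trivial, dl3, eq_comm (a := i)]
      ring
    · have key : star v ⬝ᵥ (gS3 p).mulVec v = (sS3 p ^ 2)⁻¹ *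
          (v 0 ^ 2 + v 1 ^ 2 + v 2 ^ 2 + (p.1 * v 1 - p.2.1 * v 0) ^ 2
            + (p.1 * v 2 - p.2.2 * v 0) ^ 2 + (p.2.1 * v 2 - p.2.2 * v 1) ^ 2) := by
        simp [dotProduct, Matrix.mulVec, Fin.sum_univ_three, gS3_apply, dl3, co3]
        generalize (sS3 p ^ 2)⁻¹ = c
        simp only [sS3]
        ring
      rw [key]
      have hv' : 0 < v 0 ^ 2 + v 1 ^ 2 + v 2 ^ 2 := by
        by_contra hn
        apply hv
        have h0 : v 0 = 0 := by nlinarith [sq_nonneg (v 0), sq_nonneg (v 1), sq_nonneg (v 2)]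
        have h1 : v 1 = 0 := by nlinarith [sq_nonneg (v 0), sq_nonneg (v 1), sq_nonneg (v 2)]
        have h2 : v 2 = 0 := by nlinarith [sq_nonneg (v 0), sq_nonneg (v 1), sq_nonneg (v 2)]
        ext i
        fin_cases i <;> assumption
      positivity
  · have h := (sS3_pos p).ne'
    simp only [projSymbol3, christoffel3_gS3, Fin.sum_univ_three]
    fin_cases i <;> fin_cases j <;> fin_cases k <;> simp [dl3] <;> field_simp <;> ring
end
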